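/- arXiv:1802.06419 — 2 statements merged into one kernel-verified Lean document; each statement's English description precedes it below -/
import Mathlib

section
/- Double flip around a face of degree 4 does not decrease the number of bicolored cycles: Let G = (σ_0, σ_1, σ_2, σ_3) be a colored graph on 2n vertices (d = 3). Suppose v_2 ≠ v_4 are white vertices forming a face of degree 4 with colors {1,2}: σ_1 v_2 = σ_2 v_4 =: v̄_1 and σ_1 v_4 = σ_2 v_2 =: v̄_3. Suppose the four color-0 edges incident to v_2, v_4, v̄_1, v̄_3 are pairwise distinct, i.e. σ_0 v_2 ∉ {v̄_1, v̄_3} and σ_0 v_4 ∉ {v̄_1, v̄_3}. Let w_1 = σ_0⁻¹ v̄_1, w_3 = σ_0⁻¹ v̄_3 and σ'_0 = σ_0 ∘ swap(v_4, w_3) ∘ swap(v_2, w_1). Then C_0((σ'_0, σ_1, σ_2, σ_3)) ≥ C_0(G). -/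
/-- The setoid on `α` whose classes are the cycles (orbits) of the permutation `π`. -/
def permSetoid {α : Type*} (π : Equiv.Perm α) : Setoid α :=
  ⟨π.SameCycle, ⟨fun _ => ⟨0, by simp⟩, fun h => h.symm, fun h h' => h.trans h'⟩⟩

/-- The number of cycles (orbits) of a permutation. -/
noncomputable def numCycles {α : Type*} (π : Equiv.Perm α) : ℕ :=
  Nat.card (Quotient (permSetoid π))

/-- `C_0(G) = Σ_{c=1}^{3} C_{0c}(G)` at `d = 3`, defined for any tuple (connected or not). -/
noncomputable def C0 {n : ℕ} (σ : Fin 4 → Equiv.Perm (Fin n)) : ℕ :=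
  numCycles ((σ 1)⁻¹ * σ 0) + numCycles ((σ 2)⁻¹ * σ 0) + numCycles ((σ 3)⁻¹ * σ 0)

theorem sameCycle_rel {α : Type*} (π : Equiv.Perm α) (r : Setoid α)
    (h : ∀ x, r x (π x)) {x y : α} (hxy : π.SameCycle x y) : r x y := by
  obtain ⟨i, rfl⟩ := hxy
  induction i with
  | zero => exact r.refl _
  | succ i ih =>
    have : (π ^ ((i : ℤ) + 1)) x = π ((π ^ (i : ℤ)) x) := by
      rw [add_comm, zpow_add, zpow_one, Equiv.Perm.mul_apply]
    rw [this]
    exact r.trans ih (h _)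
  | pred i ih =>
    have : (π ^ (-(i : ℤ))) x = π ((π ^ (-(i : ℤ) - 1)) x) := by
      rw [← Equiv.Perm.mul_apply, ← zpow_one_add]
      congr 2
      ring
    rw [this] at ih
    exact r.trans ih (r.symm (h _))

/-- Two points in the same cycle of `π` are in the same cycle of `π * swap a b`, up to merging
the cycles of `a` and `b`. -/
theorem sameCycle_swap {α : Type*} [DecidableEq α] (π : Equiv.Perm α) (a b : α) {x y : α}
    (hxy : π.SameCycle x y) :
    (π * Equiv.swap a b).SameCycle x y ∨
      (((π * Equiv.swap a b).SameCycle a x ∨ (π * Equiv.swap a b).SameCycle b x) ∧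
       ((π * Equiv.swap a b).SameCycle a y ∨ (π * Equiv.swap a b).SameCycle b y)) := by
  set ρ := π * Equiv.swap a b with hρ
  let r : Setoid α :=
    ⟨fun x y => ρ.SameCycle x y ∨
      ((ρ.SameCycle a x ∨ ρ.SameCycle b x) ∧ (ρ.SameCycle a y ∨ ρ.SameCycle b y)),
     ⟨fun x => Or.inl (Equiv.Perm.SameCycle.refl _ _),
      fun h => h.elim (fun h => Or.inl h.symm) (fun h => Or.inr ⟨h.2, h.1⟩),
      by
        rintro x y z (h | ⟨h, h'⟩) (k | ⟨k, k'⟩)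
        · exact Or.inl (h.trans k)
        · exact Or.inr ⟨k.imp (fun t => t.trans h.symm) (fun t => t.trans h.symm), k'⟩
        · exact Or.inr ⟨h, h'.imp (fun t => t.trans k) (fun t => t.trans k)⟩
        · exact Or.inr ⟨h, k'⟩⟩⟩
  refine sameCycle_rel π r (fun x => ?_) hxy
  change ρ.SameCycle x (π x) ∨
      ((ρ.SameCycle a x ∨ ρ.SameCycle b x) ∧ (ρ.SameCycle a (π x) ∨ ρ.SameCycle b (π x)))
  by_cases ha : x = a
  · subst ha
    have : π x = ρ b := by simp [hρ]
    rw [this]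
    exact Or.inr ⟨Or.inl (Equiv.Perm.SameCycle.refl _ _), Or.inr ⟨1, by simp⟩⟩
  by_cases hb : x = b
  · subst hb
    have : π x = ρ a := by simp [hρ]
    rw [this]
    exact Or.inr ⟨Or.inr (Equiv.Perm.SameCycle.refl _ _), Or.inl ⟨1, by simp⟩⟩
  have : π x = ρ x := by simp [hρ, Equiv.swap_apply_of_ne_of_ne ha hb]
  rw [this]
  exact Or.inl ⟨1, by simp⟩

theorem numCycles_swap_le {α : Type*} [Finite α] [DecidableEq α] (π : Equiv.Perm α) (a b : α) :
    numCycles (π * Equiv.swap a b) ≤ numCycles π + 1 := by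
  classical
  set ρ := π * Equiv.swap a b with hρ
  let f : Quotient (permSetoid ρ) → Option (Quotient (permSetoid π)) := fun q =>
    if q = Quotient.mk _ a then none else some (Quotient.mk _ q.out)
  have hf : Function.Injective f := by
    intro p q hpq
    by_cases hp : p = Quotient.mk _ a <;> by_cases hq : q = Quotient.mk _ a
    · rw [hp, hq]
    · simp [f, hp, hq] at hpq
    · simp [f, hp, hq] at hpq
    · simp only [f, hp, hq, if_false, Option.some.injEq] at hpq
      have h : π.SameCycle p.out q.out := Quotient.exact hpq
      have key : ∀ q : Quotient (permSetoid ρ), q ≠ Quotient.mk _ a →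
          ¬ ρ.SameCycle a q.out := by
        intro q hq h
        apply hq
        rw [← q.out_eq]
        exact (Quotient.sound (s := permSetoid ρ) h).symm
      rw [← p.out_eq, ← q.out_eq]
      apply Quotient.sound
      rcases sameCycle_swap π a b h with h | ⟨h | h, k | k⟩
      · exact h
      · exact absurd h (key p hp)
      · exact absurd h (key p hp)
      · exact absurd k (key q hq)
      · exact h.symm.trans k
  have := Nat.card_le_card_of_injective f hf
  rwa [Finite.card_option] at this

theorem numCycles_swap_lt {α : Type*} [Finite α] [DecidableEq α] (π : Equiv.Perm α) (a b : α)
    (h : ¬ π.SameCycle a b) (h' : (π * Equiv.swap a b).SameCycle a b) :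
    numCycles (π * Equiv.swap a b) + 1 ≤ numCycles π := by
  classical
  set ρ := π * Equiv.swap a b with hρ
  let f : Quotient (permSetoid π) → Quotient (permSetoid ρ) :=
    Quotient.map' (s₁ := permSetoid π) (s₂ := permSetoid ρ) id (by
      intro x y hxy
      rcases sameCycle_swap π a b hxy with h | ⟨h | h, k | k⟩
      · exact h
      · exact h.symm.trans k
      · exact h.symm.trans (h'.trans k)
      · exact h.symm.trans (h'.symm.trans k)
      · exact h.symm.trans k)
  have hs : Function.Surjective f := by
    intro q
    induction q using Quotient.inductionOn with
    | h x => exact ⟨Quotient.mk _ x, rfl⟩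
  have hle := Nat.card_le_card_of_surjective f hs
  refine Nat.lt_of_le_of_ne hle fun heq => h ?_
  have hb := hs.bijective_of_nat_card_le (le_of_eq heq.symm)
  have : f (Quotient.mk _ a) = f (Quotient.mk _ b) := Quotient.sound (s := permSetoid ρ) h'
  exact Quotient.exact (hb.1 this)

theorem not_sameCycle_of_pair {α : Type*} (π : Equiv.Perm α) (a c b : α)
    (h1 : π a = c) (h2 : π c = a) (hba : b ≠ a) (hbc : b ≠ c) : ¬ π.SameCycle a b := by
  intro h
  let r : Setoid α := ⟨fun x y => (x = a ∨ x = c) ↔ (y = a ∨ y = c),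
    ⟨fun _ => Iff.rfl, fun h => h.symm, fun h k => h.trans k⟩⟩
  have := sameCycle_rel π r (fun x => by
    change (x = a ∨ x = c) ↔ (π x = a ∨ π x = c)
    constructor
    · rintro (rfl | rfl) <;> tauto
    · rintro (k | k)
      · exact Or.inr (π.injective (k.trans h2.symm))
      · exact Or.inl (π.injective (k.trans h1.symm))) h
  change (a = a ∨ a = c) ↔ (b = a ∨ b = c) at this
  tauto

/-- **Double flip around a face of degree 4 does not decrease the number of bicolored
cycles** (d = 3): let `v₂ ≠ v₄` be white vertices forming a face of degree 4 with colors
`{1,2}`, i.e. `σ 1 v₂ = σ 2 v₄ = vb₁` and `σ 1 v₄ = σ 2 v₂ = vb₃`, and suppose the four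
color-0 edges incident to `v₂, v₄, vb₁, vb₃` are pairwise distinct.  Flipping first the
color-0 edges at `v₄` and `w₃ = σ₀⁻¹ vb₃`, then those at `v₂` and `w₁ = σ₀⁻¹ vb₁`, does not
decrease `C₀`. -/
theorem double_flip_degree_four_face {n : ℕ} (σ : Fin 4 → Equiv.Perm (Fin n))
    (v₂ v₄ : Fin n) (hne : v₂ ≠ v₄) (vb₁ vb₃ : Fin n)
    (h1 : σ 1 v₂ = vb₁) (h2 : σ 2 v₄ = vb₁) (h3 : σ 1 v₄ = vb₃) (h4 : σ 2 v₂ = vb₃)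
    (h5 : σ 0 v₂ ≠ vb₁) (h6 : σ 0 v₂ ≠ vb₃) (h7 : σ 0 v₄ ≠ vb₁) (h8 : σ 0 v₄ ≠ vb₃) :
    C0 σ ≤ C0 (Function.update σ 0
      (σ 0 * Equiv.swap v₄ ((σ 0)⁻¹ vb₃) * Equiv.swap v₂ ((σ 0)⁻¹ vb₁))) := by
  classical
  set w₁ := (σ 0)⁻¹ vb₁ with hw₁
  set w₃ := (σ 0)⁻¹ vb₃ with hw₃
  have e1 : σ 0 w₁ = vb₁ := by simp [hw₁]
  have e3 : σ 0 w₃ = vb₃ := by simp [hw₃]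
  have n12 : w₁ ≠ v₂ := by rintro h; exact h5 (h ▸ e1)
  have n14 : w₁ ≠ v₄ := by rintro h; exact h7 (h ▸ e1)
  have n32 : w₃ ≠ v₂ := by rintro h; exact h6 (h ▸ e3)
  have n34 : w₃ ≠ v₄ := by rintro h; exact h8 (h ▸ e3)
  have n13 : w₁ ≠ w₃ := by
    intro h
    apply hne
    apply (σ 1).injective
    rw [h1, h3, ← e1, ← e3, h]
  clear_value w₁ w₃
  set τ := σ 0 * Equiv.swap v₄ w₃ * Equiv.swap v₂ w₁ with hτ
  have t2 : τ v₂ = vb₁ := by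
    simp [hτ, Equiv.swap_apply_of_ne_of_ne n14 n13, e1]
  have t4 : τ v₄ = vb₃ := by
    simp [hτ, Equiv.swap_apply_of_ne_of_ne hne.symm n14.symm, e3]
  have hσ : σ 0 = τ * Equiv.swap v₂ w₁ * Equiv.swap v₄ w₃ := by
    simp [hτ, mul_assoc]
  clear_value τ
  have inv : ∀ c x y, σ c x = y → (σ c).symm y = x := by
    rintro c x y rfl
    simp
  unfold C0
  simp only [Function.update_self, ne_eq, Fin.reduceEq, not_false_eq_true, Function.update_of_ne]
  rw [hσ]
  simp only [← mul_assoc]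
  have c3 := numCycles_swap_le ((σ 3)⁻¹ * τ * Equiv.swap v₂ w₁) v₄ w₃
  have c3' := numCycles_swap_le ((σ 3)⁻¹ * τ) v₂ w₁
  have c2 := numCycles_swap_le ((σ 2)⁻¹ * τ * Equiv.swap v₂ w₁) v₄ w₃
  have c2' := numCycles_swap_lt ((σ 2)⁻¹ * τ) v₂ w₁
    (not_sameCycle_of_pair _ v₂ v₄ w₁ (by simp [t2, inv 2 _ _ h2])
      (by simp [t4, inv 2 _ _ h4]) n12 n14)
    (Equiv.Perm.SameCycle.symm ⟨2, by
      simp [zpow_ofNat, pow_two, t2, inv 2 _ _ h2,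
        Equiv.swap_apply_of_ne_of_ne hne.symm n14.symm, t4, inv 2 _ _ h4]⟩)
  have c1' := numCycles_swap_lt ((σ 1)⁻¹ * τ) v₂ w₁
    (not_sameCycle_of_pair _ v₂ v₂ w₁ (by simp [t2, inv 1 _ _ h1])
      (by simp [t2, inv 1 _ _ h1]) n12 n12)
    (Equiv.Perm.SameCycle.symm ⟨1, by simp [t2, inv 1 _ _ h1]⟩)
  have f4 : ((σ 1)⁻¹ * τ * Equiv.swap v₂ w₁) v₄ = v₄ := by
    simp [Equiv.swap_apply_of_ne_of_ne hne.symm n14.symm, t4, inv 1 _ _ h3]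
  have c1 := numCycles_swap_lt ((σ 1)⁻¹ * τ * Equiv.swap v₂ w₁) v₄ w₃
    (not_sameCycle_of_pair _ v₄ v₄ w₃ f4 f4 n34 n34)
    (Equiv.Perm.SameCycle.symm ⟨1, by
      rw [zpow_one, Equiv.Perm.mul_apply, Equiv.swap_apply_right, f4]⟩)
  omega
end

section
/- Classification of connected bubbles with at most six vertices at d = 3: Let (σ_1, σ_2, σ_3) be a connected bubble on 2n vertices with n ≤ 3. Then either the bubble is isomorphic, by independent relabelings of its white and of its black vertices, to a melonic bubble, or n = 3 and each of the permutations σ_1⁻¹σ_2, σ_1⁻¹σ_3, σ_2⁻¹σ_3 is a 3-cycle (in which case the underlying bipartite graph of the bubble is the complete bipartite graph K_{3,3}). -/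
/-- Extension of a permutation of `Fin n` to `Fin (n+1)` fixing `Fin.last n` and acting
through `Fin.castSucc` on the other elements. -/
def liftPerm {n : ℕ} (τ : Equiv.Perm (Fin n)) : Equiv.Perm (Fin (n + 1)) :=
  (finSuccEquivLast (n := n)).symm.permCongr τ.optionCongr

/-- Melonic tuples of permutations (melonic bubbles), defined inductively by melonic insertions
starting from the 2-vertex bubble. -/
inductive Melonic {ι : Type*} [DecidableEq ι] : {n : ℕ} → (ι → Equiv.Perm (Fin n)) → Prop
  | base : Melonic (fun _ : ι => (1 : Equiv.Perm (Fin 1)))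
  | insert {n : ℕ} {σ : ι → Equiv.Perm (Fin n)} (c : ι) (w : Fin n) :
      Melonic σ →
      Melonic (fun a =>
        if a = c then liftPerm (σ a) * Equiv.swap (Fin.castSucc w) (Fin.last n)
        else liftPerm (σ a))

/-- Connectivity of the bubble `(σ 0, σ 1, σ 2)` with three colors. -/
def BubbleConnected {n : ℕ} (σ : Fin 3 → Equiv.Perm (Fin n)) : Prop :=
  ∀ x y : Fin n,
    ∃ g ∈ Subgroup.closure {g : Equiv.Perm (Fin n) | ∃ a b : Fin 3, g = (σ a)⁻¹ * σ b},
      g x = y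

/-- The melonic insertion, as an operation on tuples. -/
def melIns {n : ℕ} (σ : Fin 3 → Equiv.Perm (Fin n)) (c : Fin 3) (w : Fin n) :
    Fin 3 → Equiv.Perm (Fin (n + 1)) := fun a =>
  if a = c then liftPerm (σ a) * Equiv.swap (Fin.castSucc w) (Fin.last n) else liftPerm (σ a)

theorem Melonic.melIns {n : ℕ} {σ : Fin 3 → Equiv.Perm (Fin n)} (h : Melonic σ)
    (c : Fin 3) (w : Fin n) : Melonic (melIns σ c w) := Melonic.insert c w h

/-- The two-vertex bubble. -/
def melBase : Fin 3 → Equiv.Perm (Fin 1) := fun _ => 1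

theorem melonic_melBase : Melonic melBase := Melonic.base

/-- A function invariant under all bicolored permutations of a connected bubble is constant. -/
theorem BubbleConnected.const {n : ℕ} {σ : Fin 3 → Equiv.Perm (Fin n)} (h : BubbleConnected σ)
    (s : Fin n → Bool) (h1 : ∀ x, s (((σ 0)⁻¹ * σ 1) x) = s x)
    (h2 : ∀ x, s (((σ 0)⁻¹ * σ 2) x) = s x) (x y : Fin n) : s x = s y := by
  have h0 : ∀ a x, s (((σ 0)⁻¹ * σ a) x) = s x := by
    intro a x
    fin_cases a
    · simp
    · exact h1 x
    · exact h2 x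
  obtain ⟨g, hg, rfl⟩ := h x y
  suffices H : ∀ x, s (g x) = s x from (H x).symm
  induction hg using Subgroup.closure_induction with
  | mem g hg =>
    obtain ⟨a, b, rfl⟩ := hg
    intro x
    rw [← h0 a, ← h0 b x]
    simp
  | one => intro x; rfl
  | mul g k _ _ ihg ihk => intro x; rw [Equiv.Perm.mul_apply, ihg, ihk]
  | inv g _ ih => intro x; rw [← ih (g⁻¹ x)]; simp

theorem melonic_of_conj {n : ℕ} {σ m : Fin 3 → Equiv.Perm (Fin n)} (hm : Melonic m)
    (ρ : Equiv.Perm (Fin n))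
    (h1 : ∀ x, m 0 (ρ (((σ 0)⁻¹ * σ 1) x)) = m 1 (ρ x))
    (h2 : ∀ x, m 0 (ρ (((σ 0)⁻¹ * σ 2) x)) = m 2 (ρ x)) :
    ∃ ρw ρb : Equiv.Perm (Fin n), Melonic (fun i => ρb * σ i * ρw⁻¹) := by
  refine ⟨ρ, m 0 * ρ * (σ 0)⁻¹, ?_⟩
  convert hm using 1
  funext i
  ext1 x
  fin_cases i
  · simp
  · simpa using h1 (ρ⁻¹ x)
  · simpa using h2 (ρ⁻¹ x)

theorem case_two : ∀ α β : Equiv.Perm (Fin 2),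
    (∃ s : Fin 2 → Bool, (∀ x, s (α x) = s x) ∧ (∀ x, s (β x) = s x) ∧ s 0 ≠ s 1) ∨
    (∃ c : Fin 3, ∃ ρ : Equiv.Perm (Fin 2),
      (∀ x, melIns melBase c 0 0 (ρ (α x)) = melIns melBase c 0 1 (ρ x)) ∧
      (∀ x, melIns melBase c 0 0 (ρ (β x)) = melIns melBase c 0 2 (ρ x))) := by
  decide +kernel

theorem case_three : ∀ α β : Equiv.Perm (Fin 3),
    (∃ s : Fin 3 → Bool, (∀ x, s (α x) = s x) ∧ (∀ x, s (β x) = s x) ∧ ∃ x y, s x ≠ s y) ∨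
    (∃ c d : Fin 3, ∃ w : Fin 2, ∃ ρ : Equiv.Perm (Fin 3),
      (∀ x, melIns (melIns melBase c 0) d w 0 (ρ (α x)) =
        melIns (melIns melBase c 0) d w 1 (ρ x)) ∧
      (∀ x, melIns (melIns melBase c 0) d w 0 (ρ (β x)) =
        melIns (melIns melBase c 0) d w 2 (ρ x))) ∨
    ((α.support.card = 3) ∧ (β.support.card = 3) ∧ ((α⁻¹ * β).support.card = 3)) := by
  decide +kernel

/-- **Classification of connected bubbles with at most six vertices at `d = 3`**: a connected
bubble on `2n ≤ 6` vertices is either isomorphic, by independent relabelings of its white and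
black vertices, to a melonic bubble, or `n = 3` and each of its three bicolored permutations
is a 3-cycle (the bubble is then the complete bipartite graph `K₃,₃`). -/
theorem small_bubble_classification {n : ℕ} (hn : 1 ≤ n) (hn3 : n ≤ 3)
    (σ : Fin 3 → Equiv.Perm (Fin n)) (hconn : BubbleConnected σ) :
    (∃ ρw ρb : Equiv.Perm (Fin n), Melonic (fun i => ρb * σ i * ρw⁻¹)) ∨
      (n = 3 ∧ Equiv.Perm.IsThreeCycle ((σ 0)⁻¹ * σ 1) ∧
        Equiv.Perm.IsThreeCycle ((σ 0)⁻¹ * σ 2) ∧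
        Equiv.Perm.IsThreeCycle ((σ 1)⁻¹ * σ 2)) := by
  have hn' : n = 1 ∨ n = 2 ∨ n = 3 := by omega
  rcases hn' with rfl | rfl | rfl
  · left
    refine ⟨1, 1, ?_⟩
    convert melonic_melBase using 1
    funext i
    exact Subsingleton.elim _ _
  · left
    rcases case_two ((σ 0)⁻¹ * σ 1) ((σ 0)⁻¹ * σ 2) with ⟨s, h1, h2, h⟩ | ⟨c, ρ, h1, h2⟩
    · exact absurd (hconn.const s h1 h2 0 1) h
    · exact melonic_of_conj (melonic_melBase.melIns c 0) ρ h1 h2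
  · rcases case_three ((σ 0)⁻¹ * σ 1) ((σ 0)⁻¹ * σ 2) with
      ⟨s, h1, h2, x, y, h⟩ | ⟨c, d, w, ρ, h1, h2⟩ | ⟨h1, h2, h3⟩
    · exact absurd (hconn.const s h1 h2 x y) h
    · exact Or.inl (melonic_of_conj ((melonic_melBase.melIns c 0).melIns d w) ρ h1 h2)
    · right
      refine ⟨rfl, card_support_eq_three_iff.1 h1,
        card_support_eq_three_iff.1 h2, card_support_eq_three_iff.1 ?_⟩
      have e : ((σ 0)⁻¹ * σ 1)⁻¹ * ((σ 0)⁻¹ * σ 2) = (σ 1)⁻¹ * σ 2 := by group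
      rwa [e] at h3
end
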